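/- Let A = A₀ ⊕ A₁ be a ℤ/2ℤ-graded commutative ring such that (A₀, m₀) is a Noetherian local ring of Krull dimension d, A₁ is a nonzero finitely generated A₀-module with μ_{A₀}(A₁) = 2, and x·y ∈ m₀ for all x, y ∈ A₁, so that A is a Noetherian local ring. Let q be the ideal of A₀ generated by all products x·y with x, y ∈ A₁. Then A is a regular local ring if and only if all of the following hold: (i) A₀ is a domain with d ≥ 2 whose embedding dimension equals d + 1 (i.e., A₀ is a non-regular hypersurface domain); (ii) A₁ is isomorphic as an A₀-module to an ideal I of A₀ with μ_{A₀}(I) = 2; (iii) q = (a₁, a₂, a₃) for elements a₁, a₂, a₃ ∈ m₀ whose images in m₀/m₀² are linearly independent over the residue field A₀/m₀ (i.e., a₁, a₂, a₃ form part of a minimal generating set of m₀). -/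

import Mathlib

open IsLocalRing

/-- The minimal number of generators `μ_R(M)` of an `R`-module `M`: the least cardinality
of a finite generating set. -/
noncomputable def minGen (R M : Type*) [Semiring R] [AddCommMonoid M] [Module R M] : ℕ :=
  sInf {n : ℕ | ∃ s : Finset M, s.card = n ∧ Submodule.span R (s : Set M) = ⊤}


theorem krull_rad {R : Type*} [CommRing R] [IsNoetherianRing R] [IsLocalRing R] (s : Finset R)
    (hs : (s : Set R) ⊆ maximalIdeal R)
    (h : maximalIdeal R ≤ (Ideal.span (s : Set R)).radical) : ringKrullDim R ≤ s.card := by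
  rw [← IsLocalRing.maximalIdeal_height_eq_ringKrullDim]
  have : (maximalIdeal R).height ≤ s.card := by
    apply Ideal.height_le_card_of_mem_minimalPrimes_span_finset
    refine ⟨⟨inferInstance, Ideal.span_le.2 hs⟩, ?_⟩
    rintro q ⟨hq, hq2⟩ _
    exact h.trans ((hq.radical_le_iff).2 hq2)
  exact_mod_cast this

theorem dim_le_of_integral {R S : Type*} [CommRing R] [CommRing S] [Algebra R S]
    [Algebra.IsIntegral R S] [FaithfulSMul R S] (d : ℕ) (h : (d : WithBot ℕ∞) ≤ ringKrullDim R) :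
    (d : WithBot ℕ∞) ≤ ringKrullDim S := by
  obtain ⟨l, hl⟩ := Order.le_krullDim_iff.1 h
  obtain ⟨P, _, hP, hP2⟩ := Ideal.exists_ideal_over_prime_of_isIntegral (S := S)
    l.head.asIdeal ⊥ (by
      rw [← RingHom.ker_eq_comap_bot, (RingHom.injective_iff_ker_eq_bot _).1 (FaithfulSMul.algebraMap_injective R S)]
      exact bot_le)
  have : P.LiesOver l.head.asIdeal := ⟨hP2.symm⟩
  obtain ⟨L, hL, _⟩ := Ideal.exists_ltSeries_of_hasGoingUp l P
  exact Order.le_krullDim_iff.2 ⟨L, hL.trans hl⟩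

theorem minGen_le {R M : Type*} [Semiring R] [AddCommMonoid M] [Module R M] (s : Finset M)
    (hs : Submodule.span R (s : Set M) = ⊤) : minGen R M ≤ s.card :=
  Nat.sInf_le ⟨s, rfl, hs⟩

theorem minGen_spec (R M : Type*) [Semiring R] [AddCommMonoid M] [Module R M]
    [Module.Finite R M] : ∃ s : Finset M, s.card = minGen R M ∧
    Submodule.span R (s : Set M) = ⊤ := by
  obtain ⟨s, hs⟩ := Module.Finite.fg_top (R := R) (M := M)
  exact Nat.sInf_mem (s := {n : ℕ | ∃ s : Finset M, s.card = n ∧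
    Submodule.span R (s : Set M) = ⊤}) ⟨_, s, rfl, hs⟩

theorem minGen_equiv {R M N : Type*} [Semiring R] [AddCommMonoid M] [Module R M]
    [AddCommMonoid N] [Module R N] [Module.Finite R M]
    (e : M ≃ₗ[R] N) : minGen R N ≤ minGen R M := by
  classical
  obtain ⟨s, hs, hs2⟩ := minGen_spec R M
  rw [← hs]
  refine (minGen_le (s.image e) ?_).trans Finset.card_image_le
  rw [Finset.coe_image, ← LinearEquiv.coe_coe, ← Submodule.map_span, hs2]
  simp

theorem minGen_ideal_le {R M : Type*} [CommRing R] [AddCommGroup M] [Module R M]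
    (N : Submodule R M) (s : Finset M)
    (hs : Submodule.span R (s : Set M) = N) : minGen R N ≤ s.card := by
  classical
  subst hs
  have := minGen_le (R := R) (M := Submodule.span R (s : Set M))
    (s.attach.image fun x => ⟨x.1, Submodule.subset_span x.2⟩) (by
      convert Submodule.span_span_coe_preimage (R := R) (s := (s : Set M)) using 2
      ext x; simp [Subtype.ext_iff])
  exact this.trans (Finset.card_image_le.trans (by simp))

theorem minGen_ideal_spec {R M : Type*} [CommRing R] [AddCommGroup M] [Module R M]
    (N : Submodule R M) (hN : N.FG) : ∃ s : Finset M, s.card = minGen R N ∧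
      Submodule.span R (s : Set M) = N := by
  classical
  have : Module.Finite R N := Module.Finite.iff_fg.2 hN
  obtain ⟨s, hs, hs2⟩ := minGen_spec R N
  refine ⟨s.image N.subtype, ?_, ?_⟩
  · rw [Finset.card_image_of_injective _ N.injective_subtype, hs]
  · rw [Finset.coe_image, ← Submodule.map_span, hs2]; simp

theorem minGen_max_eq {R : Type*} [CommRing R] [IsNoetherianRing R] [IsLocalRing R] :
    minGen R (maximalIdeal R) = Module.finrank (ResidueField R) (CotangentSpace R) := by
  have hfg : (maximalIdeal R).FG := IsNoetherian.noetherian _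
  rw [← IsLocalRing.spanFinrank_maximalIdeal_eq_finrank_cotangentSpace]
  apply le_antisymm
  · obtain ⟨s, hs, hs2⟩ := Submodule.FG.exists_span_finset_card_eq_spanFinrank hfg
    rw [← hs]
    exact minGen_ideal_le _ _ hs2
  · obtain ⟨s, hs, hs2⟩ := minGen_ideal_spec _ hfg
    rw [← hs]
    have := Submodule.spanFinrank_span_le_ncard_of_finite (R := R) s.finite_toSet
    rwa [hs2, Set.ncard_coe_finset] at this

theorem isDomain_of_regular (d : ℕ) : ∀ {R : Type*} [CommRing R] [IsNoetherianRing R]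
    [IsLocalRing R] (_ : (d : WithBot ℕ∞) ≤ ringKrullDim R) (s : Finset R)
    (_ : s.card ≤ d) (_ : Ideal.span (s : Set R) = maximalIdeal R), IsDomain R := by
  classical
  induction d with
  | zero =>
    intro R _ _ _ _ s hs hspan
    have : s = ∅ := by simpa using hs
    subst this
    have : IsField R := by
      rw [IsLocalRing.isField_iff_maximalIdeal_eq, ← hspan]; simp
    exact this.isDomain
  | succ d ih =>
    intro R _ _ _ hd s hs hspan
    have hfield : maximalIdeal R ^ 2 < maximalIdeal R := by
      apply IsLocalRing.maximalIdeal_sq_lt_of_ringKrullDim_ne_zero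
      refine (lt_of_lt_of_le ?_ hd).ne'
      exact_mod_cast Nat.succ_pos d
    have hmin : (minimalPrimes R).Finite := minimalPrimes.finite_of_isNoetherianRing R
    -- the maximal ideal is not a minimal prime
    have hnotmin : ∀ p ∈ minimalPrimes R, ¬ maximalIdeal R ≤ p := by
      intro p hp hle
      have hp' : p.IsPrime := hp.1.1
      have : p = maximalIdeal R := le_antisymm (IsLocalRing.le_maximalIdeal hp'.ne_top) hle
      have h0 : ringKrullDim R ≤ (∅ : Finset R).card := by
        apply krull_rad
        · simp
        · intro x hx
          simp only [Finset.coe_empty, Ideal.span_empty]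
          rw [Ideal.radical_eq_sInf, Ideal.mem_sInf]
          rintro J ⟨_, hJ⟩
          have h2 := hp.2 (y := J) ⟨hJ, bot_le⟩ (by
            rw [this]; exact IsLocalRing.le_maximalIdeal hJ.ne_top)
          exact h2 (hle hx)
      have := hd.trans h0
      simp only [Finset.card_empty] at this
      have h3 : d + 1 ≤ 0 := by exact_mod_cast this
      omega
    obtain ⟨a, ha, ha2, ha3⟩ : ∃ a ∈ maximalIdeal R, a ∉ maximalIdeal R ^ 2 ∧
        ∀ p ∈ minimalPrimes R, a ∉ p := by
      by_contra hcon
      push Not at hcon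
      have := (Ideal.subset_union_prime (s := insert (maximalIdeal R ^ 2) hmin.toFinset)
        (f := id) (maximalIdeal R ^ 2) (maximalIdeal R ^ 2) (I := maximalIdeal R) (by
          intro i hi hne _
          rw [Finset.mem_insert] at hi
          have := (hmin.mem_toFinset).1 (hi.resolve_left hne)
          exact this.1.1)).1 (by
          intro x hx
          simp only [Set.mem_iUnion]
          by_cases hx2 : x ∈ maximalIdeal R ^ 2
          · exact ⟨maximalIdeal R ^ 2, by simp, hx2⟩
          · obtain ⟨p, hp, hxp⟩ := hcon x hx hx2
            exact ⟨p, by simp [hp], hxp⟩)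
      obtain ⟨i, hi, hle⟩ := this
      rw [Finset.mem_insert] at hi
      rcases hi with rfl | hi
      · exact absurd hle (not_le_of_gt hfield)
      · exact hnotmin i (hmin.mem_toFinset.1 hi) hle
    -- exchange
    obtain ⟨i, his, hi⟩ : ∃ i ∈ s, i ∈ Ideal.span (insert a (s.erase i : Set R)) := by
      have h1 : a ∈ Ideal.span (s : Set R) := hspan ▸ ha
      obtain ⟨c, hc⟩ := (Submodule.mem_span_finset' (R := R)).1 h1
      by_contra hcon
      push Not at hcon
      apply ha2
      rw [← hc]
      refine Ideal.sum_mem _ fun j _ => ?_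
      rw [pow_two]
      refine Ideal.mul_mem_mul ?_ (hspan ▸ Ideal.subset_span j.2)
      by_contra hu
      have hu : IsUnit (c j) := by simpa using hu
      obtain ⟨u, hu⟩ := hu
      apply hcon j j.2
      have : (j : R) = ↑u⁻¹ * (a - ∑ k ∈ Finset.univ.erase j, c k • (k : R)) := by
        rw [← hc, ← Finset.add_sum_erase _ _ (Finset.mem_univ j), add_sub_cancel_right, ← hu]
        simp
      suffices hmem : ↑u⁻¹ * (a - ∑ k ∈ Finset.univ.erase j, c k • (k : R)) ∈
          Ideal.span (insert a (s.erase (j : R) : Set R)) by rwa [← this] at hmem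
      refine Ideal.mul_mem_left _ _ (Ideal.sub_mem _ (Ideal.subset_span (by simp)) ?_)
      refine Ideal.sum_mem _ fun k hk => Ideal.mul_mem_left _ _ (Ideal.subset_span ?_)
      right
      have : k ≠ j := (Finset.mem_erase.1 hk).1
      exact Finset.mem_coe.2 (Finset.mem_erase.2 ⟨fun h => this (Subtype.ext h), k.2⟩)
    let I := Ideal.span ({a} : Set R)
    have hI : I ≤ maximalIdeal R := (Ideal.span_singleton_le_iff_mem _).2 ha
    have : Nontrivial (R ⧸ I) := Ideal.Quotient.nontrivial_iff.2
      (fun h => Ideal.IsPrime.ne_top' (top_le_iff.1 (h ▸ hI)))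
    have : IsLocalRing (R ⧸ I) := IsLocalRing.of_surjective' (Ideal.Quotient.mk I)
      Ideal.Quotient.mk_surjective
    have hmax : maximalIdeal (R ⧸ I) = (maximalIdeal R).map (Ideal.Quotient.mk I) := by
      symm
      apply IsLocalRing.eq_maximalIdeal
      have := IsLocalRing.maximalIdeal.isMaximal R
      refine (Ideal.map_eq_top_or_isMaximal_of_surjective _ Ideal.Quotient.mk_surjective
        this).resolve_left ?_
      intro h
      have := Ideal.comap_map_of_surjective _ (Ideal.Quotient.mk_surjective (I := I))
        (maximalIdeal R)
      rw [h, Ideal.comap_top, ← RingHom.ker_eq_comap_bot, Ideal.mk_ker, sup_eq_left.2 hI] at this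
      exact Ideal.IsPrime.ne_top' this.symm
    have hdom : IsDomain (R ⧸ I) := by
      refine ih ?_ ((s.erase i).image (Ideal.Quotient.mk I)) ?_ ?_
      · have := ringKrullDim_le_ringKrullDim_quotient_add_card ({a} : Finset R) (by
          rw [IsLocalRing.ringJacobson_eq_maximalIdeal]
          simpa using ha)
        have h2 := hd.trans this
        rw [Finset.coe_singleton, Finset.card_singleton] at h2
        have h3 : (d : WithBot ℕ∞) + 1 ≤ ringKrullDim (R ⧸ I) + 1 := by exact_mod_cast h2
        exact ENat.WithBot.add_le_add_one_right_iff.1 h3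
      · refine Finset.card_image_le.trans ?_
        rw [Finset.card_erase_of_mem his]; omega
      · rw [hmax, Finset.coe_image, ← Ideal.map_span, ← hspan]
        apply le_antisymm
        · exact Ideal.map_mono (Ideal.span_mono (by simp))
        · rw [Ideal.map_le_iff_le_comap, Ideal.span_le]
          have key : Ideal.span (insert a (s.erase i : Set R)) ≤ Ideal.comap (Ideal.Quotient.mk I)
            (Ideal.map (Ideal.Quotient.mk I) (Ideal.span (s.erase i : Set R))) := by
            rw [Ideal.span_le, Set.insert_subset_iff]
            constructor
            · have : Ideal.Quotient.mk I a = 0 :=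
                Ideal.Quotient.eq_zero_iff_mem.2 (Ideal.mem_span_singleton_self a)
              rw [SetLike.mem_coe, Ideal.mem_comap]
              rw [this]; exact Ideal.zero_mem _
            · intro x hx
              exact Ideal.mem_map_of_mem _ (Ideal.subset_span hx)
          intro j hj
          by_cases hji : j = i
          · subst hji; exact key hi
          · exact key (Ideal.subset_span (by right; simpa [hji] using hj))
    have hIp : I.IsPrime := (Ideal.Quotient.isDomain_iff_prime I).1 hdom
    obtain ⟨p, hp, hpI⟩ := Ideal.exists_minimalPrimes_le (bot_le : (⊥ : Ideal R) ≤ I)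
    have hpp : p.IsPrime := hp.1.1
    have hap : a ∉ p := ha3 p hp
    have : p = ⊥ := by
      apply Submodule.eq_bot_of_le_smul_of_le_jacobson_bot I p (IsNoetherian.noetherian _)
      · intro y hy
        obtain ⟨b, rfl⟩ := Ideal.mem_span_singleton'.1 (hpI hy)
        rw [mul_comm]
        exact Submodule.smul_mem_smul (Ideal.mem_span_singleton_self a)
          ((hpp.mem_or_mem hy).resolve_right hap)
      · rw [IsLocalRing.jacobson_eq_maximalIdeal _ bot_ne_top]; exact hI
    rw [this] at hpp
    exact IsDomain.of_bot_isPrime R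

theorem exists_complement {R : Type*} [CommRing R] [IsNoetherianRing R] [IsLocalRing R]
    {ι : Type*} [Fintype ι] (a : ι → maximalIdeal R)
    (ha : LinearIndependent (ResidueField R) (fun i => (maximalIdeal R).toCotangent (a i) :
      ι → CotangentSpace R))
    (T : Set (maximalIdeal R)) (hT : Submodule.span R (Set.range a ∪ T) = ⊤) :
    ∃ w : Finset (maximalIdeal R), (w : Set (maximalIdeal R)) ⊆ T ∧
      w.card + Fintype.card ι = minGen R (maximalIdeal R) ∧
      Submodule.span R (Set.range a ∪ (w : Set (maximalIdeal R))) = ⊤ := by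
  classical
  let f : maximalIdeal R → CotangentSpace R := fun m => (maximalIdeal R).toCotangent m
  have hS : LinearIndepOn (ResidueField R) id (Set.range fun i => f (a i)) :=
    LinearIndependent.linearIndepOn_id ha
  have hT2 : Submodule.span (ResidueField R) (f '' (Set.range a ∪ T)) = ⊤ :=
    IsLocalRing.CotangentSpace.span_image_eq_top_iff.2 hT
  have hsub : (Set.range fun i => f (a i)) ⊆ f '' (Set.range a ∪ T) := by
    rintro _ ⟨i, rfl⟩
    exact ⟨a i, Or.inl ⟨i, rfl⟩, rfl⟩
  obtain ⟨b, hbT, hSb, hTb, hb⟩ := exists_linearIndepOn_id_extension hS hsub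
  have hbtop : Submodule.span (ResidueField R) b = ⊤ := by
    rw [← top_le_iff, ← hT2]
    exact Submodule.span_le.2 hTb
  have hbfin : b.Finite := hb.linearIndependent.setFinite
  have hcard : b.ncard = minGen R (maximalIdeal R) := by
    rw [minGen_max_eq]
    have : Fintype b := hbfin.fintype
    rw [← finrank_top (ResidueField R) (CotangentSpace R), ← hbtop,
      finrank_span_set_eq_card hb, ← Set.ncard_eq_toFinset_card']
  have hScard : (Set.range fun i => f (a i)).ncard = Fintype.card ι := by
    rw [← Set.image_univ, Set.ncard_image_of_injective _ ha.injective, Set.ncard_univ,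
      Nat.card_eq_fintype_card]
  have hdiff : b \ (Set.range fun i => f (a i)) ⊆ f '' T := by
    rintro v ⟨hv, hv2⟩
    obtain ⟨m, hm | hm, rfl⟩ := hbT hv
    · obtain ⟨i, rfl⟩ := hm
      exact absurd ⟨i, rfl⟩ hv2
    · exact ⟨m, hm, rfl⟩
  obtain ⟨w, hwT, hw⟩ := Set.subset_image_iff.1 hdiff
  obtain ⟨w', hw'w, hbij⟩ := (Set.surjOn_image f w).exists_bijOn_subset
  have hw'fin : w'.Finite := by
    apply Set.Finite.of_finite_image _ hbij.injOn
    rw [hbij.image_eq, hw]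
    exact hbfin.subset Set.sdiff_subset
  refine ⟨hw'fin.toFinset, by simpa using hw'w.trans hwT, ?_, ?_⟩
  · have h1 : hw'fin.toFinset.card = (b \ (Set.range fun i => f (a i))).ncard := by
      rw [← Set.ncard_eq_toFinset_card _ hw'fin, ← hw, ← hbij.image_eq, hbij.injOn.ncard_image]
    rw [h1, ← hScard, ← hcard, Set.ncard_sdiff_add_ncard_of_subset hSb hbfin]
  · rw [← IsLocalRing.CotangentSpace.span_image_eq_top_iff, ← top_le_iff, ← hbtop]
    refine Submodule.span_mono ?_
    intro v hv
    by_cases hv2 : v ∈ Set.range fun i => f (a i)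
    · obtain ⟨i, rfl⟩ := hv2
      exact ⟨a i, Or.inl ⟨i, rfl⟩, rfl⟩
    · have : v ∈ f '' w' := by rw [hbij.image_eq, hw]; exact ⟨hv, hv2⟩
      obtain ⟨m, hm, rfl⟩ := this
      exact ⟨m, Or.inr (by simpa using hm), rfl⟩

theorem linIndep_cotangent {R : Type*} [CommRing R] [IsLocalRing R]
    {ι : Type*} [Fintype ι] (a : ι → maximalIdeal R)
    (h : ∀ c : ι → R, ∑ i, c i * (a i : R) ∈ maximalIdeal R ^ 2 → ∀ i, c i ∈ maximalIdeal R) :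
    LinearIndependent (ResidueField R) (fun i => (maximalIdeal R).toCotangent (a i) :
      ι → CotangentSpace R) := by
  rw [Fintype.linearIndependent_iff]
  intro g hg
  choose c hc using fun i => IsLocalRing.residue_surjective (g i)
  have h1 : (maximalIdeal R).toCotangent (∑ i, c i • a i) = 0 := by
    rw [map_sum, ← hg]
    refine Finset.sum_congr rfl fun i _ => ?_
    rw [map_smul, ← hc]
    rfl
  rw [Ideal.toCotangent_eq_zero] at h1
  intro i
  rw [← hc, IsLocalRing.residue_eq_zero_iff]
  apply h c _ i
  convert h1
  simp

theorem quad_rel {R : Type*} [CommRing R] [IsNoetherianRing R] [IsLocalRing R]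
    (D : ℕ) (hD : (D : WithBot ℕ∞) ≤ ringKrullDim R) (x y : R) (z : Finset R)
    (hspan : Ideal.span ({x, y} ∪ (z : Set R)) = maximalIdeal R) (hcard : z.card + 2 ≤ D)
    (a b c : R) (h : a * x ^ 2 + b * (x * y) + c * y ^ 2 ∈ Ideal.span (z : Set R)) :
    a ∈ maximalIdeal R ∧ b ∈ maximalIdeal R ∧ c ∈ maximalIdeal R := by
  classical
  have hsm : ({x, y} ∪ (z : Set R)) ⊆ maximalIdeal R := by
    rw [← hspan]; exact Ideal.subset_span
  have hx : x ∈ maximalIdeal R := hsm (by simp)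
  have hy : y ∈ maximalIdeal R := hsm (by simp)
  have hz : (z : Set R) ⊆ maximalIdeal R := fun t ht => hsm (Or.inr ht)
  -- main contradiction
  have key : ∀ w v u : R, w ∈ maximalIdeal R → IsUnit u → u * v ^ 2 ∈ Ideal.span (insert w (z : Set R)) →
      x ∈ Ideal.span (insert w (insert v (z : Set R))) →
      y ∈ Ideal.span (insert w (insert v (z : Set R))) → False := by
    intro w v u hw hu huv hxw hyw
    have hv : v ∈ (Ideal.span (insert w (z : Set R))).radical :=
      ⟨2, (Ideal.unit_mul_mem_iff_mem _ hu).1 huv⟩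
    have hle : Ideal.span (insert w (z : Set R)) ≤ (Ideal.span (insert w (z : Set R))).radical :=
      Ideal.le_radical
    have h3 : Ideal.span (insert w (insert v (z : Set R))) ≤
        (Ideal.span (insert w (z : Set R))).radical := by
      rw [Ideal.span_le, Set.insert_subset_iff, Set.insert_subset_iff]
      refine ⟨hle (Ideal.subset_span (by simp)), hv, fun t ht => hle (Ideal.subset_span ?_)⟩
      exact Or.inr ht
    have := krull_rad (insert w z) (by
      rw [Finset.coe_insert]; exact Set.insert_subset hw hz) (by
      rw [Finset.coe_insert, ← hspan, Ideal.span_le]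
      rintro t ((rfl | rfl) | ht)
      · exact h3 hxw
      · exact h3 hyw
      · exact hle (Ideal.subset_span (Or.inr ht)))
    have h4 := hD.trans this
    have h5 : D ≤ (insert w z).card := by exact_mod_cast h4
    have := Finset.card_insert_le w z
    omega
  have hmono : ∀ w, Ideal.span (z : Set R) ≤ Ideal.span (insert w (z : Set R)) :=
    fun w => Ideal.span_mono (Set.subset_insert _ _)
  have hwmem : ∀ w, w ∈ Ideal.span (insert w (z : Set R)) :=
    fun w => Ideal.subset_span (by simp)
  have ha : a ∈ maximalIdeal R := by
    by_contra hu
    refine key y x a hy (by simpa using hu) ?_ (Ideal.subset_span (by simp))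
      (Ideal.subset_span (by simp))
    have := Ideal.sub_mem _ (hmono y h) (Ideal.mul_mem_left _ (b * x + c * y) (hwmem y))
    convert this using 1; ring
  have hc : c ∈ maximalIdeal R := by
    by_contra hu
    refine key x y c hx (by simpa using hu) ?_ (Ideal.subset_span (by simp))
      (Ideal.subset_span (by simp))
    have := Ideal.sub_mem _ (hmono x h) (Ideal.mul_mem_left _ (a * x + b * y) (hwmem x))
    convert this using 1; ring
  refine ⟨ha, ?_, hc⟩
  by_contra hu
  have habc : a + b + c ∉ maximalIdeal R := by
    intro hh
    apply hu
    have := Ideal.sub_mem _ hh (Ideal.add_mem _ ha hc)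
    convert this using 1; ring
  refine key (y - x) x (a + b + c) (Ideal.sub_mem _ hy hx) (by simpa using habc) ?_
    (Ideal.subset_span (by simp)) ?_
  · have := Ideal.sub_mem _ (hmono (y - x) h)
      (Ideal.mul_mem_left _ (b * x + c * (y + x)) (hwmem (y - x)))
    convert this using 1; ring
  · have := Ideal.add_mem (Ideal.span (insert (y - x) (insert x (z : Set R))))
      (Ideal.subset_span (by simp) : (y - x) ∈ _) (Ideal.subset_span (by simp) : x ∈ _)
    simpa using this

/-- Let `A = A₀ ⊕ A₁` be a `ℤ/2ℤ`-graded commutative ring (`A₀` a subring, `A₁` an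
`A₀`-submodule, `A = A₀ ⊕ A₁` additively, `A₁·A₁ ⊆ A₀`) with `(A₀, m₀)` a Noetherian
local ring of Krull dimension `d`, `A₁` a nonzero finitely generated `A₀`-module with
`μ_{A₀}(A₁) = 2`, and `x·y ∈ m₀` for all `x, y ∈ A₁`, so that `A` is a Noetherian local
ring. Let `q ⊆ A₀` be the ideal generated by all products `x·y` with `x, y ∈ A₁`.
Then `A` is regular (i.e. `dim A = v(A)`) iff:
(i) `A₀` is a domain with `d ≥ 2` and embedding dimension `d + 1` (a non-regular
hypersurface domain); (ii) `A₁ ≅ I` for an ideal `I` of `A₀` with `μ_{A₀}(I) = 2`; and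
(iii) `q = (a₁, a₂, a₃)` for elements `a₁, a₂, a₃ ∈ m₀` whose images in `m₀/m₀²` are
linearly independent over the residue field. -/
theorem regular_iff_of_z2graded_mu_two {A : Type*} [CommRing A]
    (A₀ : Subring A) (A₁ : Submodule A₀ A)
    [IsNoetherianRing A₀] [IsLocalRing A₀]
    (d : ℕ) (hd : ringKrullDim A₀ = d)
    (hgr : ∀ x ∈ A₁, ∀ y ∈ A₁, x * y ∈ A₀)
    (hdisj : A₀.toAddSubgroup ⊓ A₁.toAddSubgroup = ⊥)
    (hspan : A₀.toAddSubgroup ⊔ A₁.toAddSubgroup = ⊤)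
    (hA₁ne : A₁ ≠ ⊥) (hA₁fg : A₁.FG) (hA₁mu : minGen A₀ A₁ = 2)
    (hm : ∀ x ∈ A₁, ∀ y ∈ A₁, ∀ h : x * y ∈ A₀, (⟨x * y, h⟩ : A₀) ∈ maximalIdeal A₀)
    [IsNoetherianRing A] [IsLocalRing A] :
    ringKrullDim A = (minGen A (maximalIdeal A) : WithBot ℕ∞) ↔
      ((IsDomain A₀ ∧ 2 ≤ d ∧ minGen A₀ (maximalIdeal A₀) = d + 1) ∧
       (∃ I : Ideal A₀, Nonempty (A₁ ≃ₗ[A₀] I) ∧ minGen A₀ I = 2) ∧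
       (∃ a₁ a₂ a₃ : A₀, ∃ h₁ : a₁ ∈ maximalIdeal A₀, ∃ h₂ : a₂ ∈ maximalIdeal A₀,
          ∃ h₃ : a₃ ∈ maximalIdeal A₀,
          Ideal.span {a : A₀ | ∃ x ∈ A₁, ∃ y ∈ A₁, (a : A) = x * y} =
            Ideal.span {a₁, a₂, a₃} ∧
          LinearIndependent (ResidueField A₀)
            ![(maximalIdeal A₀).toCotangent ⟨a₁, h₁⟩,
              (maximalIdeal A₀).toCotangent ⟨a₂, h₂⟩,
              (maximalIdeal A₀).toCotangent ⟨a₃, h₃⟩])) := by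
  classical
  -- decomposition facts
  have dec : ∀ a : A, ∃ u : A₀, ∃ v ∈ A₁, a = u + v := by
    intro a
    have : a ∈ A₀.toAddSubgroup ⊔ A₁.toAddSubgroup := by rw [hspan]; trivial
    obtain ⟨u, hu, v, hv, h⟩ := AddSubgroup.mem_sup.1 this
    exact ⟨⟨u, hu⟩, v, hv, h.symm⟩
  have uniq0 : ∀ (u : A₀), ∀ v ∈ A₁, (u : A) + v = 0 → u = 0 ∧ v = 0 := by
    intro u v hv h
    have hmem : (u : A) ∈ A₀.toAddSubgroup ⊓ A₁.toAddSubgroup := by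
      refine ⟨u.2, ?_⟩
      have : (u : A) = -v := eq_neg_of_add_eq_zero_left h
      rw [this]
      exact A₁.neg_mem hv
    rw [hdisj] at hmem
    have hu : (u : A) = 0 := hmem
    refine ⟨Subtype.ext hu, ?_⟩
    simpa [hu] using h
  have uniq : ∀ (u u' : A₀), ∀ v ∈ A₁, ∀ v' ∈ A₁, (u : A) + v = u' + v' → u = u' ∧ v = v' := by
    intro u u' v hv v' hv' h
    have := uniq0 (u - u') (v - v') (A₁.sub_mem hv hv') (by push_cast; linear_combination h)
    exact ⟨sub_eq_zero.1 this.1, sub_eq_zero.1 this.2⟩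
  have smul1 : ∀ (u : A₀), ∀ v ∈ A₁, (u : A) * v ∈ A₁ := fun u v hv => A₁.smul_mem u hv
  have smul1' : ∀ (u : A₀), ∀ v ∈ A₁, v * (u : A) ∈ A₁ := fun u v hv => by
    rw [mul_comm]; exact smul1 u v hv
  -- maximal ideal
  have memn : ∀ u : A₀, (u : A) ∈ maximalIdeal A ↔ u ∈ maximalIdeal A₀ := by
    intro u
    rw [mem_maximalIdeal, mem_maximalIdeal, mem_nonunits_iff, mem_nonunits_iff, not_iff_not]
    constructor
    · intro h
      obtain ⟨b, hb⟩ := h.exists_right_inv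
      obtain ⟨b0, b1, hb1, rfl⟩ := dec b
      have := uniq (u * b0) 1 (u * b1) (smul1 _ _ hb1) 0 A₁.zero_mem (by
        push_cast; linear_combination hb)
      exact IsUnit.of_mul_eq_one _ this.1
    · intro h
      exact h.map A₀.subtype
  have memn1 : ∀ v ∈ A₁, v ∈ maximalIdeal A := by
    intro v hv
    have h1 : v * v ∈ maximalIdeal A := (memn ⟨v * v, hgr v hv v hv⟩).2 (hm v hv v hv _)
    exact (Ideal.IsPrime.mem_or_mem inferInstance h1).elim id id
  -- finiteness and dimension
  have hfin : Module.Finite A₀ A := by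
    have htop : Submodule.span A₀ ({1} : Set A) ⊔ A₁ = ⊤ := by
      rw [eq_top_iff]
      intro a _
      obtain ⟨u, v, hv, rfl⟩ := dec a
      refine Submodule.add_mem_sup ?_ hv
      exact Submodule.mem_span_singleton.2 ⟨u, by simp [Subring.smul_def]⟩
    refine ⟨?_⟩
    rw [← htop]
    exact (Submodule.fg_span_singleton _).sup hA₁fg
  have hdimA : ringKrullDim A = d := by
    apply le_antisymm
    · have hht : (maximalIdeal A₀).height = d := by
        have := IsLocalRing.maximalIdeal_height_eq_ringKrullDim (R := A₀)
        rw [hd] at this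
        exact_mod_cast this
      obtain ⟨s, hs, hsc⟩ := (maximalIdeal A₀).exists_finset_card_eq_height_of_isNoetherianRing
      rw [hht] at hsc
      have hsc' : s.card = d := by exact_mod_cast hsc
      have hrad : (Ideal.span (s : Set A₀)).radical = maximalIdeal A₀ := by
        rw [← Ideal.sInf_minimalPrimes]
        apply le_antisymm
        · exact sInf_le hs
        · refine le_sInf fun p hp => ?_
          exact hs.2 ⟨hp.1.1, hp.1.2⟩ (IsLocalRing.le_maximalIdeal hp.1.1.ne_top)
      have h1 := krull_rad (R := A) (s.image A₀.subtype) (by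
        intro t ht
        rw [Finset.coe_image] at ht
        obtain ⟨u, hu, rfl⟩ := ht
        exact (memn u).2 (hs.1.2 (Ideal.subset_span hu))) (by
        rw [Finset.coe_image, ← Ideal.map_span]
        have h0 : ∀ u ∈ maximalIdeal A₀, (u : A) ∈
            (Ideal.map A₀.subtype (Ideal.span (s : Set A₀))).radical := by
          intro u hu
          rw [← hrad] at hu
          obtain ⟨k, hk⟩ := hu
          refine ⟨k, ?_⟩
          have := Ideal.mem_map_of_mem A₀.subtype hk
          simpa using this
        intro a ha
        obtain ⟨u, v, hv, rfl⟩ := dec a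
        refine Ideal.add_mem _ (h0 u ?_) ?_
        · rw [← memn]
          simpa using Ideal.sub_mem _ ha (memn1 v hv)
        · have := h0 ⟨v * v, hgr v hv v hv⟩ (hm v hv v hv _)
          have h2 : v ^ 2 ∈ (Ideal.map A₀.subtype (Ideal.span (s : Set A₀))).radical := by
            rw [pow_two]; exact this
          have h3 : v ∈ (Ideal.map A₀.subtype (Ideal.span (s : Set A₀))).radical.radical := ⟨2, h2⟩
          rwa [Ideal.radical_idem] at h3)
      refine h1.trans ?_
      rw [← hsc']
      exact_mod_cast Finset.card_image_le
    · have : Algebra.IsIntegral A₀ A := inferInstance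
      exact dim_le_of_integral (R := A₀) (S := A) d hd.ge
  -- generators of A₁
  obtain ⟨x, y, hxy⟩ : ∃ x y : A, Submodule.span A₀ ({x, y} : Set A) = A₁ := by
    obtain ⟨s, hs, hs2⟩ := minGen_ideal_spec A₁ hA₁fg
    rw [hA₁mu] at hs
    obtain ⟨x, y, _, rfl⟩ := Finset.card_eq_two.1 hs
    exact ⟨x, y, by simpa using hs2⟩
  have hx : x ∈ A₁ := by rw [← hxy]; exact Submodule.subset_span (by simp)
  have hy : y ∈ A₁ := by rw [← hxy]; exact Submodule.subset_span (by simp)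
  have rep : ∀ v ∈ A₁, ∃ α β : A₀, v = α * x + β * y := by
    intro v hv
    rw [← hxy] at hv
    obtain ⟨α, β, h⟩ := Submodule.mem_span_pair.1 hv
    exact ⟨α, β, h.symm⟩
  have not1 : ∀ t : A, Submodule.span A₀ ({t} : Set A) ≠ A₁ := by
    intro t ht
    have := minGen_ideal_le A₁ {t} (by simpa using ht)
    rw [hA₁mu] at this
    simp at this
  have indep : ∀ α β : A₀, (α : A) * x + β * y = 0 → α ∈ maximalIdeal A₀ ∧ β ∈ maximalIdeal A₀ := by
    have aux : ∀ (s t : A), Submodule.span A₀ ({s, t} : Set A) = A₁ → ∀ α β : A₀,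
        (α : A) * s + β * t = 0 → α ∈ maximalIdeal A₀ := by
      intro s t hst α β h
      by_contra hu
      have hu : IsUnit α := by simpa using hu
      obtain ⟨γ, hγ⟩ := hu.exists_left_inv
      apply not1 t
      rw [← hst, Set.insert_eq, Submodule.span_union, eq_comm, sup_eq_right,
        Submodule.span_singleton_le_iff_mem]
      refine Submodule.mem_span_singleton.2 ⟨-(γ * β), ?_⟩
      have hγ' : (γ : A) * α = 1 := by exact_mod_cast congrArg Subtype.val hγ
      rw [Subring.smul_def, smul_eq_mul]
      push_cast
      linear_combination -(γ : A) * h + s * hγ'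
    intro α β h
    exact ⟨aux x y hxy α β h, aux y x (by rw [Set.pair_comm]; exact hxy) β α (by
      rw [add_comm]; exact h)⟩
  have hdomx : x ≠ 0 := by
    rintro rfl
    apply not1 y
    rw [← hxy, Set.insert_eq, Submodule.span_union]
    simp
  let X : A₀ := ⟨x * x, hgr x hx x hx⟩
  let Y : A₀ := ⟨x * y, hgr x hx y hy⟩
  let Z : A₀ := ⟨y * y, hgr y hy y hy⟩
  have hX : X ∈ maximalIdeal A₀ := hm _ hx _ hx _
  have hY : Y ∈ maximalIdeal A₀ := hm _ hx _ hy _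
  have hZ : Z ∈ maximalIdeal A₀ := hm _ hy _ hy _
  have hq : Ideal.span {a : A₀ | ∃ x ∈ A₁, ∃ y ∈ A₁, (a : A) = x * y} = Ideal.span {X, Y, Z} := by
    apply le_antisymm
    · rw [Ideal.span_le]
      rintro a ⟨s, hs, t, ht, h⟩
      obtain ⟨α, β, rfl⟩ := rep s hs
      obtain ⟨γ, δ, rfl⟩ := rep t ht
      have : a = (α * γ) * X + (α * δ + β * γ) * Y + (β * δ) * Z := by
        apply Subtype.ext
        push_cast
        rw [h]
        ring
      rw [this]
      refine Ideal.add_mem _ (Ideal.add_mem _ ?_ ?_) ?_ <;>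
      exact Ideal.mul_mem_left _ _ (Ideal.subset_span (by simp))
    · apply Ideal.span_mono
      rintro a (rfl | rfl | rfl)
      · exact ⟨x, hx, x, hx, rfl⟩
      · exact ⟨x, hx, y, hy, rfl⟩
      · exact ⟨y, hy, y, hy, rfl⟩
  -- generators of the maximal ideal of A from those of m₀ modulo q
  have gens : ∀ (b : Set A₀) (w : Finset A₀), (w : Set A₀) ⊆ maximalIdeal A₀ →
      b ⊆ (Ideal.span {X, Y, Z} : Ideal A₀) → maximalIdeal A₀ ≤ Ideal.span (b ∪ (w : Set A₀)) →
      Ideal.span (({x, y} ∪ ((w.image A₀.subtype : Finset A) : Set A)) : Set A) =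
        maximalIdeal A := by
    intro b w hw hb hle
    set N := Ideal.span (({x, y} ∪ ((w.image A₀.subtype : Finset A) : Set A)) : Set A) with hN
    have hxN : x ∈ N := Ideal.subset_span (by simp)
    have hyN : y ∈ N := Ideal.subset_span (by simp)
    apply le_antisymm
    · rw [hN, Ideal.span_le]
      rintro t ((rfl | rfl) | ht)
      · exact memn1 _ hx
      · exact memn1 _ hy
      · rw [Finset.coe_image] at ht
        obtain ⟨u, hu, rfl⟩ := ht
        exact (memn u).2 (hw hu)
    · have hqN : Ideal.span {X, Y, Z} ≤ N.comap A₀.subtype := by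
        rw [Ideal.span_le]
        rintro t (rfl | rfl | rfl)
        · exact N.mul_mem_left x hxN
        · exact N.mul_mem_left x hyN
        · exact N.mul_mem_left y hyN
      have h1 : Ideal.span (b ∪ (w : Set A₀)) ≤ N.comap A₀.subtype := by
        rw [Ideal.span_le]
        rintro t (ht | ht)
        · exact hqN (hb ht)
        · exact Ideal.subset_span (Or.inr (by
            rw [Finset.coe_image]; exact ⟨t, ht, rfl⟩))
      intro a ha
      obtain ⟨u, v, hv, rfl⟩ := dec a
      have hu : u ∈ maximalIdeal A₀ := by
        rw [← memn]
        simpa using Ideal.sub_mem _ ha (memn1 v hv)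
      refine Ideal.add_mem _ (h1 (hle hu)) ?_
      obtain ⟨α, β, rfl⟩ := rep v hv
      exact Ideal.add_mem _ (N.mul_mem_left _ hxN) (N.mul_mem_left _ hyN)
  -- Krull bound
  have krullA : ∀ s : Finset A, Ideal.span (s : Set A) = maximalIdeal A → d ≤ s.card := by
    intro s hs
    have := krull_rad s (hs ▸ Ideal.subset_span) (hs ▸ Ideal.le_radical)
    rw [hdimA] at this
    exact_mod_cast this
  have hnfg : (maximalIdeal A).FG := IsNoetherian.noetherian _
  have three : ∀ a₁ a₂ a₃ : A₀, ∀ h₁ : a₁ ∈ maximalIdeal A₀, ∀ h₂ : a₂ ∈ maximalIdeal A₀,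
      ∀ h₃ : a₃ ∈ maximalIdeal A₀, Ideal.span {X, Y, Z} = Ideal.span {a₁, a₂, a₃} →
      LinearIndependent (ResidueField A₀)
            ![(maximalIdeal A₀).toCotangent ⟨a₁, h₁⟩,
              (maximalIdeal A₀).toCotangent ⟨a₂, h₂⟩,
              (maximalIdeal A₀).toCotangent ⟨a₃, h₃⟩] →
      ∃ g : Finset A, Ideal.span (g : Set A) = maximalIdeal A ∧
        g.card + 1 ≤ minGen A₀ (maximalIdeal A₀) := by
    intro a₁ a₂ a₃ h₁ h₂ h₃ hsp hli
    let a : Fin 3 → maximalIdeal A₀ := ![⟨a₁, h₁⟩, ⟨a₂, h₂⟩, ⟨a₃, h₃⟩]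
    have hli' : LinearIndependent (ResidueField A₀)
        (fun i => (maximalIdeal A₀).toCotangent (a i) : Fin 3 → CotangentSpace A₀) := by
      convert hli using 1
      funext i
      fin_cases i <;> rfl
    obtain ⟨w, _, hwc, hwspan⟩ := exists_complement a hli' Set.univ (by simp)
    let w' : Finset A₀ := w.image (maximalIdeal A₀).subtype
    have hgen := gens {a₁, a₂, a₃} w' (by
        intro t ht
        rw [Finset.coe_image] at ht
        obtain ⟨u, hu, rfl⟩ := ht
        exact u.2) (by
        rw [hsp]; exact Ideal.subset_span) (by
        have := congrArg (Submodule.map (maximalIdeal A₀).subtype) hwspan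
        rw [Submodule.map_span, Submodule.map_top, Submodule.range_subtype] at this
        rw [← this]
        refine Ideal.span_mono ?_
        rintro _ ⟨t, ⟨i, rfl⟩ | ht, rfl⟩
        · left
          fin_cases i <;> simp [a]
        · right
          rw [Finset.coe_image]; exact ⟨t, ht, rfl⟩)
    refine ⟨{x, y} ∪ w'.image A₀.subtype, by rw [Finset.coe_union, Finset.coe_pair]; exact hgen, ?_⟩
    have c1 := Finset.card_union_le ({x, y} : Finset A) (w'.image A₀.subtype)
    have c2 : ({x, y} : Finset A).card ≤ 2 := Finset.card_le_two
    have c3 : (w'.image A₀.subtype).card ≤ w'.card := Finset.card_image_le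
    have c4 : w'.card ≤ w.card := Finset.card_image_le
    rw [Fintype.card_fin] at hwc
    omega
  rw [hq]
  constructor
  swap
  · rintro ⟨⟨_, _, hedim⟩, _, a₁, a₂, a₃, h₁, h₂, h₃, hsp, hli⟩
    obtain ⟨g, hg, hgc⟩ := three a₁ a₂ a₃ h₁ h₂ h₃ hsp hli
    rw [hedim] at hgc
    have u1 := minGen_ideal_le (maximalIdeal A) g hg
    obtain ⟨s, hs, hs2⟩ := minGen_ideal_spec (maximalIdeal A) hnfg
    have u2 := krullA s hs2
    rw [hdimA]
    have : d = minGen A (maximalIdeal A) := by omega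
    rw [← this]
  · intro hreg
    rw [hdimA] at hreg
    have hedimA : d = minGen A (maximalIdeal A) := by exact_mod_cast hreg
    have hdom : IsDomain A := by
      obtain ⟨s, hs, hs2⟩ := minGen_ideal_spec (maximalIdeal A) hnfg
      exact isDomain_of_regular d hdimA.ge s (by omega) hs2
    have sq : ∀ w ∈ maximalIdeal A ^ 2, ∃ u μ ν : A₀, μ ∈ maximalIdeal A₀ ∧
        ν ∈ maximalIdeal A₀ ∧ w = u + (μ * x + ν * y) := by
      intro w hw
      rw [pow_two] at hw
      refine Submodule.mul_induction_on hw ?_ ?_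
      · intro s hs t ht
        obtain ⟨u, v, hv, rfl⟩ := dec s
        obtain ⟨u', v', hv', rfl⟩ := dec t
        have hu : u ∈ maximalIdeal A₀ := by
          rw [← memn]; simpa using Ideal.sub_mem _ hs (memn1 v hv)
        have hu' : u' ∈ maximalIdeal A₀ := by
          rw [← memn]; simpa using Ideal.sub_mem _ ht (memn1 v' hv')
        have hvv := hgr v hv v' hv'
        obtain ⟨α, β, h1⟩ := rep v hv
        obtain ⟨α', β', h2⟩ := rep v' hv'
        refine ⟨u * u' + ⟨v * v', hvv⟩, u * α' + u' * α, u * β' + u' * β, ?_, ?_, ?_⟩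
        · exact Ideal.add_mem _ (Ideal.mul_mem_right _ _ hu) (Ideal.mul_mem_right _ _ hu')
        · exact Ideal.add_mem _ (Ideal.mul_mem_right _ _ hu) (Ideal.mul_mem_right _ _ hu')
        · push_cast
          linear_combination (u' : A) * h1 + (u : A) * h2
      · rintro _ _ ⟨u, μ, ν, hμ, hν, rfl⟩ ⟨u', μ', ν', hμ', hν', rfl⟩
        refine ⟨u + u', μ + μ', ν + ν', Ideal.add_mem _ hμ hμ', Ideal.add_mem _ hν hν', ?_⟩
        push_cast; ring
    -- x, y independent in the cotangent space of A
    let e : Fin 2 → maximalIdeal A := ![⟨x, memn1 x hx⟩, ⟨y, memn1 y hy⟩]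
    have hli : LinearIndependent (ResidueField A)
        (fun i => (maximalIdeal A).toCotangent (e i) : Fin 2 → CotangentSpace A) := by
      apply linIndep_cotangent
      intro c hc
      rw [Fin.sum_univ_two] at hc
      change c 0 * x + c 1 * y ∈ _ at hc
      obtain ⟨u, μ, ν, hμ, hν, h⟩ := sq _ hc
      obtain ⟨α, v, hv, h0⟩ := dec (c 0)
      obtain ⟨β, v', hv', h1⟩ := dec (c 1)
      have h2 := uniq (⟨v * x, hgr v hv x hx⟩ + ⟨v' * y, hgr v' hv' y hy⟩) u
        (α * x + β * y) (A₁.add_mem (smul1 _ _ hx) (smul1 _ _ hy)) (μ * x + ν * y)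
        (A₁.add_mem (smul1 _ _ hx) (smul1 _ _ hy)) (by
          rw [← h, h0, h1]; push_cast; ring)
      have h3 := indep (α - μ) (β - ν) (by push_cast; linear_combination h2.2)
      have h4 : α ∈ maximalIdeal A₀ := by simpa using Ideal.add_mem _ h3.1 hμ
      have h5 : β ∈ maximalIdeal A₀ := by simpa using Ideal.add_mem _ h3.2 hν
      intro i
      fin_cases i
      · change c 0 ∈ _
        rw [h0]; exact Ideal.add_mem _ ((memn _).2 h4) (memn1 v hv)
      · change c 1 ∈ _
        rw [h1]; exact Ideal.add_mem _ ((memn _).2 h5) (memn1 v' hv')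
    obtain ⟨w, hwT, hwc, hwspan⟩ := exists_complement e hli
      {t | ∃ u : A₀, (t : A) = u} (by
        rw [eq_top_iff]
        rintro ⟨t, ht⟩ _
        obtain ⟨u, v, hv, rfl⟩ := dec t
        obtain ⟨α, β, rfl⟩ := rep v hv
        have hu : (u : A) ∈ maximalIdeal A := by simpa using Ideal.sub_mem _ ht (memn1 _ hv)
        have : (⟨_, ht⟩ : maximalIdeal A) = ⟨u, hu⟩ + ((α : A) • e 0 + (β : A) • e 1) := by
          apply Subtype.ext
          simp [e]
        rw [this]
        refine Submodule.add_mem _ (Submodule.subset_span (Or.inr ⟨u, rfl⟩))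
          (Submodule.add_mem _ ?_ ?_)
        · exact Submodule.smul_mem _ _ (Submodule.subset_span (Or.inl ⟨0, rfl⟩))
        · exact Submodule.smul_mem _ _ (Submodule.subset_span (Or.inl ⟨1, rfl⟩)))
    rw [Fintype.card_fin, ← hedimA] at hwc
    -- lift to A₀
    obtain ⟨z, hzm, hzc, hzspan⟩ : ∃ z : Finset A₀, (z : Set A₀) ⊆ maximalIdeal A₀ ∧
        z.card + 2 ≤ d ∧
        Ideal.span (({x, y} ∪ ((z.image A₀.subtype : Finset A) : Set A)) : Set A) =
          maximalIdeal A := by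
      have hex : ∀ t : maximalIdeal A, ∃ u : A₀, t ∈ w → (t : A) = u := by
        intro t
        by_cases ht : t ∈ w
        · obtain ⟨u, hu⟩ := hwT ht
          exact ⟨u, fun _ => hu⟩
        · exact ⟨0, fun h => absurd h ht⟩
      choose f hf using hex
      have hfm : ((w.image f : Finset A₀) : Set A₀) ⊆ maximalIdeal A₀ := by
        intro u hu
        rw [Finset.coe_image] at hu
        obtain ⟨t, ht, rfl⟩ := hu
        rw [SetLike.mem_coe, ← memn, ← hf t ht]
        exact t.2
      refine ⟨w.image f, hfm, ?_, ?_⟩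
      · have : (w.image f).card ≤ w.card := Finset.card_image_le
        omega
      · apply le_antisymm
        · rw [Ideal.span_le]
          rintro t ((rfl | rfl) | ht)
          · exact memn1 _ hx
          · exact memn1 _ hy
          · rw [Finset.coe_image] at ht
            obtain ⟨u, hu, rfl⟩ := ht
            exact (memn u).2 (hfm hu)
        · have := congrArg (Submodule.map (maximalIdeal A).subtype) hwspan
          rw [Submodule.map_span, Submodule.map_top, Submodule.range_subtype] at this
          refine this.ge.trans (Submodule.span_mono ?_)
          rintro _ ⟨t, ⟨i, rfl⟩ | ht, rfl⟩
          · left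
            fin_cases i <;> simp [e]
          · right
            rw [Finset.coe_image]
            refine ⟨f t, ?_, ?_⟩
            · rw [Finset.coe_image]; exact ⟨t, ht, rfl⟩
            · exact (hf t ht).symm
    -- degree zero part of the ideal generated by z
    have deg0 : ∀ s ∈ Ideal.span ((z.image A₀.subtype : Finset A) : Set A),
        ∃ s0 ∈ Ideal.span (z : Set A₀), ∃ v ∈ A₁, s = s0 + v := by
      intro s hs
      suffices H : ∀ r : A, ∃ s0 ∈ Ideal.span (z : Set A₀), ∃ v ∈ A₁, r * s = s0 + v by
        simpa using H 1
      refine Submodule.span_induction ?_ ?_ ?_ ?_ hs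
      · intro t ht r
        rw [Finset.coe_image] at ht
        obtain ⟨u, hu, rfl⟩ := ht
        obtain ⟨r0, r1, hr1, rfl⟩ := dec r
        refine ⟨r0 * u, Ideal.mul_mem_left _ _ (Ideal.subset_span hu), r1 * u,
          smul1' _ _ hr1, ?_⟩
        push_cast
        rw [Subring.subtype_apply]
        ring
      · intro r
        exact ⟨0, Ideal.zero_mem _, 0, A₁.zero_mem, by simp⟩
      · intro s t _ _ h h' r
        obtain ⟨s0, h0, v, hv, e1⟩ := h r
        obtain ⟨s0', h0', v', hv', e2⟩ := h' r
        exact ⟨s0 + s0', Ideal.add_mem _ h0 h0', v + v', A₁.add_mem hv hv', by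
          push_cast; linear_combination e1 + e2⟩
      · intro a s _ h r
        obtain ⟨s0, h0, v, hv, e1⟩ := h (r * a)
        exact ⟨s0, h0, v, hv, by rw [smul_eq_mul, ← mul_assoc]; exact e1⟩
    have hq' : ∀ v ∈ A₁, ∀ v' ∈ A₁, ∀ h : v * v' ∈ A₀,
        (⟨v * v', h⟩ : A₀) ∈ Ideal.span {X, Y, Z} := by
      intro v hv v' hv' h
      rw [← hq]
      exact Ideal.subset_span ⟨v, hv, v', hv', rfl⟩
    have hm0 : maximalIdeal A₀ = Ideal.span ({X, Y, Z} ∪ (z : Set A₀)) := by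
      apply le_antisymm
      · intro u hu
        have hu' := (memn u).2 hu
        rw [← hzspan, Ideal.span_union] at hu'
        obtain ⟨p, hp, s, hs, hps⟩ := Submodule.mem_sup.1 hu'
        obtain ⟨c1, c2, rfl⟩ := Ideal.mem_span_pair.1 hp
        obtain ⟨s0, hs0, v, hv, rfl⟩ := deg0 s hs
        obtain ⟨α1, v1, hv1, rfl⟩ := dec c1
        obtain ⟨α2, v2, hv2, rfl⟩ := dec c2
        have h1 := uniq u (⟨v1 * x, hgr _ hv1 _ hx⟩ + ⟨v2 * y, hgr _ hv2 _ hy⟩ + s0) 0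
          A₁.zero_mem (α1 * x + α2 * y + v)
          (A₁.add_mem (A₁.add_mem (smul1 _ _ hx) (smul1 _ _ hy)) hv) (by
            rw [← hps]; push_cast; ring)
        rw [h1.1, Ideal.span_union]
        exact Submodule.add_mem_sup (Ideal.add_mem _ (hq' _ hv1 _ hx _) (hq' _ hv2 _ hy _)) hs0
      · rw [Ideal.span_le]
        rintro t ((rfl | rfl | rfl) | ht)
        · exact hX
        · exact hY
        · exact hZ
        · exact hzm ht
    have hzA : ∀ s ∈ Ideal.span (z : Set A₀),
        (s : A) ∈ Ideal.span ((z.image A₀.subtype : Finset A) : Set A) := by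
      intro s hs
      rw [Finset.coe_image, ← Ideal.map_span]
      exact Ideal.mem_map_of_mem A₀.subtype hs
    have rel : ∀ α β γ : A₀, α * X + β * Y + γ * Z ∈ maximalIdeal A₀ ^ 2 →
        α ∈ maximalIdeal A₀ ∧ β ∈ maximalIdeal A₀ ∧ γ ∈ maximalIdeal A₀ := by
      intro α β γ h
      have claim : ∀ u ∈ maximalIdeal A₀ ^ 2, ∃ p1 ∈ maximalIdeal A₀, ∃ p2 ∈ maximalIdeal A₀,
          ∃ p3 ∈ maximalIdeal A₀, ∃ t ∈ Ideal.span (z : Set A₀),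
          u = p1 * X + p2 * Y + p3 * Z + t := by
        intro u hu
        rw [pow_two] at hu
        refine Submodule.mul_induction_on hu ?_ ?_
        · intro m hmm n hn
          rw [hm0, Ideal.span_union] at hn
          obtain ⟨p, hp, s, hs, rfl⟩ := Submodule.mem_sup.1 hn
          obtain ⟨a1, a2, a3, rfl⟩ := Submodule.mem_span_triple.1 hp
          refine ⟨m * a1, Ideal.mul_mem_right _ _ hmm, m * a2, Ideal.mul_mem_right _ _ hmm,
            m * a3, Ideal.mul_mem_right _ _ hmm, m * s, Ideal.mul_mem_left _ _ hs, ?_⟩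
          simp only [smul_eq_mul]
          ring
        · rintro _ _ ⟨p1, h1, p2, h2, p3, h3, t, ht, rfl⟩ ⟨q1, k1, q2, k2, q3, k3, t', ht', rfl⟩
          exact ⟨p1 + q1, Ideal.add_mem _ h1 k1, p2 + q2, Ideal.add_mem _ h2 k2,
            p3 + q3, Ideal.add_mem _ h3 k3, t + t', Ideal.add_mem _ ht ht', by ring⟩
      obtain ⟨p1, h1, p2, h2, p3, h3, t, ht, hu⟩ := claim _ h
      have huA : (α : A) * (x * x) + β * (x * y) + γ * (y * y) =
          p1 * (x * x) + p2 * (x * y) + p3 * (y * y) + t := congrArg Subtype.val hu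
      have := quad_rel d hdimA.ge x y (z.image A₀.subtype) hzspan
        (le_trans (Nat.add_le_add_right Finset.card_image_le 2) hzc)
        ((α - p1 : A₀) : A) ((β - p2 : A₀) : A) ((γ - p3 : A₀) : A) (by
          have h4 := hzA t ht
          convert h4 using 1
          push_cast
          linear_combination huA)
      rw [memn, memn, memn] at this
      refine ⟨?_, ?_, ?_⟩
      · simpa using Ideal.add_mem _ this.1 h1
      · simpa using Ideal.add_mem _ this.2.1 h2
      · simpa using Ideal.add_mem _ this.2.2 h3
    have hli3 : LinearIndependent (ResidueField A₀)
            ![(maximalIdeal A₀).toCotangent ⟨X, hX⟩,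
              (maximalIdeal A₀).toCotangent ⟨Y, hY⟩,
              (maximalIdeal A₀).toCotangent ⟨Z, hZ⟩] := by
      have := linIndep_cotangent (R := A₀) ![⟨X, hX⟩, ⟨Y, hY⟩, ⟨Z, hZ⟩] (by
        intro c hc
        rw [Fin.sum_univ_three] at hc
        have := rel (c 0) (c 1) (c 2) hc
        intro i
        fin_cases i
        · exact this.1
        · exact this.2.1
        · exact this.2.2)
      convert this using 1
      funext i
      fin_cases i <;> rfl
    refine ⟨⟨inferInstance, by omega, ?_⟩, ?_, X, Y, Z, hX, hY, hZ, rfl, hli3⟩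
    · obtain ⟨g, hg, hgc⟩ := three X Y Z hX hY hZ rfl hli3
      have c0 := krullA g hg
      have c1 := minGen_ideal_le (maximalIdeal A₀) ({X, Y, Z} ∪ z) (by
        rw [hm0, Finset.coe_union]; simp)
      have c2 := Finset.card_union_le ({X, Y, Z} : Finset A₀) z
      have c3 : ({X, Y, Z} : Finset A₀).card ≤ 3 := Finset.card_le_three
      omega
    · let φ : A₁ →ₗ[A₀] A₀ :=
        { toFun := fun v => ⟨v * x, hgr v v.2 x hx⟩
          map_add' := fun v v' => Subtype.ext (by simp [add_mul])
          map_smul' := fun c v => Subtype.ext (by simp [Subring.smul_def, mul_assoc]) }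
      have hφ : Function.Injective φ := by
        intro v v' h
        have h2 : (v : A) * x = v' * x := congrArg Subtype.val h
        exact Subtype.ext (mul_right_cancel₀ hdomx h2)
      let E := LinearEquiv.ofInjective φ hφ
      have : Module.Finite A₀ A₁ := Module.Finite.iff_fg.2 hA₁fg
      refine ⟨LinearMap.range φ, ⟨E⟩, ?_⟩
      apply le_antisymm
      · rw [← hA₁mu]; exact minGen_equiv E
      · rw [← hA₁mu]; exact minGen_equiv E.symm
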